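/- Define the gyromotion ρ_ω(t) := (b(x_ω(t)) × v_ω(t))/(ω |B(x_ω(t))|). Then for every fixed T > 0 its time average is negligible to first order: ω · (1/T) ∫₀ᵀ ρ_ω(t) dt → 0 as ω → ∞. -/

import Mathlib

open MeasureTheory Filter RealInnerProductSpace

noncomputable section

abbrev E3 := EuclideanSpace ℝ (Fin 3)

/-- Cross product on `E3`. -/
def cross (u v : E3) : E3 :=
  !₂[u 1 * v 2 - u 2 * v 1, u 2 * v 0 - u 0 * v 2, u 0 * v 1 - u 1 * v 0]

/-- Partial derivative of `f` in the `i`-th coordinate direction. -/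
def pd (f : E3 → E3) (i : Fin 3) (x : E3) : E3 := fderiv ℝ f x (EuclideanSpace.single i 1)

/-- Curl of a vector field. -/
def curl (f : E3 → E3) (x : E3) : E3 :=
  !₂[pd f 1 x 2 - pd f 2 x 1, pd f 2 x 0 - pd f 0 x 2, pd f 0 x 1 - pd f 1 x 0]

/-- Divergence of a vector field. -/
def divergence (f : E3 → E3) (x : E3) : ℝ := ∑ i, pd f i x i
/-- Convergence in $C^{0,\alpha}_{loc}$ as $\omega\to\infty$: for every compact
$K\subset\mathbb{R}$ the $\alpha$-Hölder norm of $f_\omega - g$ on $K$ tends to $0$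
(both the sup part and the Hölder seminorm part become arbitrarily small). -/
def HolderLocConv {E : Type*} [NormedAddCommGroup E] (f : ℝ → ℝ → E) (g : ℝ → E)
    (α : ℝ) : Prop :=
  ∀ K : Set ℝ, IsCompact K → ∀ ε > 0, ∃ W : ℝ, ∀ ω ≥ W,
    (∀ t ∈ K, ‖f ω t - g t‖ ≤ ε) ∧
    ∀ s ∈ K, ∀ t ∈ K, ‖(f ω s - g s) - (f ω t - g t)‖ ≤ ε * |s - t| ^ α

theorem cross_swap (u v : E3) : cross u v = -cross v u := by
  ext i
  fin_cases i <;> simp [cross] <;> ring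

theorem cross_smul_left (c : ℝ) (u v : E3) : cross (c • u) v = c • cross u v := by
  ext i
  fin_cases i <;> simp [cross] <;> ring

theorem inner_cross_self (u v : E3) : inner ℝ u (cross u v) = 0 := by
  simp [cross, PiLp.inner_apply, Fin.sum_univ_three]
  ring

theorem ContDiff.deriv_of_two {E : Type*} [NormedAddCommGroup E] [NormedSpace ℝ E] {x : ℝ → E}
    (hx : ContDiff ℝ 2 x) : ContDiff ℝ 1 (deriv x) := by
  rw [← one_add_one_eq_two] at hx
  exact (contDiff_succ_iff_deriv.1 hx).2.2

/-- The integral of a weighted acceleration `g (x t) • x'' t` is controlled by the speed, when the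
speed is constant and `g` is bounded in `C¹` along the trajectory. -/
theorem norm_integral_smul_deriv_deriv_le {E : Type*} [NormedAddCommGroup E] [NormedSpace ℝ E]
    [CompleteSpace E] {g : E → ℝ} (hg : ContDiff ℝ 1 g) {x : ℝ → E} (hx : ContDiff ℝ 2 x)
    {T s C D : ℝ} (hT : 0 ≤ T) (hs : ∀ t, ‖deriv x t‖ = s)
    (hC : ∀ t ∈ Set.Icc 0 T, ‖g (x t)‖ ≤ C) (hD : ∀ t ∈ Set.Icc 0 T, ‖fderiv ℝ g (x t)‖ ≤ D) :
    ‖∫ t in (0:ℝ)..T, g (x t) • deriv (deriv x) t‖ ≤ 2 * (C * s) + D * s * s * T := by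
  have hs0 : 0 ≤ s := hs 0 ▸ norm_nonneg _
  have hx' : ContDiff ℝ 1 (deriv x) := hx.deriv_of_two
  have hxc : Continuous x := hx.continuous
  have hvc : Continuous (deriv x) := hx'.continuous
  have hac : Continuous (deriv (deriv x)) := hx'.continuous_deriv le_rfl
  have hgc : Continuous fun t => g (x t) := hg.continuous.comp hxc
  have hgd : Continuous fun t => fderiv ℝ g (x t) := (hg.continuous_fderiv one_ne_zero).comp hxc
  have hgv : Continuous fun t => fderiv ℝ g (x t) (deriv x t) := hgd.clm_apply hvc
  have hderiv : ∀ t, HasDerivAt (fun t => g (x t) • deriv x t)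
      (g (x t) • deriv (deriv x) t + fderiv ℝ g (x t) (deriv x t) • deriv x t) t := fun t =>
    ((hg.differentiable one_ne_zero (x t)).hasFDerivAt.comp_hasDerivAt t
      (hx.differentiable two_ne_zero t).hasDerivAt).smul
      (hx'.differentiable one_ne_zero t).hasDerivAt
  have hftc := intervalIntegral.integral_eq_sub_of_hasDerivAt (a := 0) (b := T)
    (fun t _ => hderiv t) (((hgc.smul hac).add (hgv.smul hvc)).intervalIntegrable _ _)
  have hadd := intervalIntegral.integral_add (μ := volume)
    ((hgc.smul hac).intervalIntegrable 0 T) ((hgv.smul hvc).intervalIntegrable 0 T)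
  simp only [Pi.smul_apply'] at hadd
  rw [hadd] at hftc
  have hboundary : ∀ t ∈ Set.Icc 0 T, ‖g (x t) • deriv x t‖ ≤ C * s := fun t ht => by
    rw [norm_smul, hs]
    exact mul_le_mul_of_nonneg_right (hC t ht) hs0
  have hrest : ‖∫ t in (0:ℝ)..T, fderiv ℝ g (x t) (deriv x t) • deriv x t‖ ≤ D * s * s * T := by
    have h := intervalIntegral.norm_integral_le_of_norm_le_const (a := 0) (b := T)
      (f := fun t => fderiv ℝ g (x t) (deriv x t) • deriv x t) (C := D * s * s) fun t ht => by
        rw [Set.uIoc_of_le hT] at ht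
        rw [norm_smul, hs]
        refine mul_le_mul_of_nonneg_right ?_ hs0
        refine (ContinuousLinearMap.le_opNorm _ _).trans ?_
        rw [hs]
        exact mul_le_mul_of_nonneg_right (hD t ⟨ht.1.le, ht.2⟩) hs0
    rwa [sub_zero, abs_of_nonneg hT] at h
  rw [eq_sub_of_add_eq hftc]
  refine (norm_sub_le _ _).trans (add_le_add ((norm_sub_le _ _).trans ?_) hrest)
  linarith [hboundary T ⟨hT, le_rfl⟩, hboundary 0 ⟨le_rfl, hT⟩]

theorem norm_deriv_eq_of_lorentz {B : E3 → E3} {x : ℝ → E3} (hx : ContDiff ℝ 2 x) {ω : ℝ}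
    (hode : ∀ t, deriv (deriv x) t = ω • cross (deriv x t) (B (x t))) (t : ℝ) :
    ‖deriv x t‖ = ‖deriv x 0‖ := by
  have hx' : ContDiff ℝ 1 (deriv x) := hx.deriv_of_two
  have hd : ∀ t, HasDerivAt (fun t => ‖deriv x t‖ ^ 2) 0 t := fun t => by
    have h := (hx'.differentiable one_ne_zero t).hasDerivAt.norm_sq
    rwa [hode t, inner_smul_right, inner_cross_self, mul_zero, mul_zero] at h
  have hsq := is_const_of_deriv_eq_zero (fun t => (hd t).differentiableAt)
    (fun t => (hd t).deriv) t 0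
  exact (sq_eq_sq₀ (norm_nonneg _) (norm_nonneg _)).1 hsq

/-- The time average of the gyromotion $\rho_\omega$ is $o(1/\omega)$:
$\omega\cdot\frac1T\int_0^T\rho_\omega\,dt\to 0$ as $\omega\to\infty$. -/
theorem stmt10 (B : E3 → E3) (hB : ContDiff ℝ 2 B) (hne : ∀ y : E3, B y ≠ 0)
    (hdiv : ∀ y : E3, divergence B y = 0) (x₀ v₀ : E3)
    (b : E3 → E3) (hb : b = fun y => ‖B y‖⁻¹ • B y)
    (xω : ℝ → ℝ → E3)
    (hxC : ∀ ω > (0:ℝ), ContDiff ℝ 2 (xω ω))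
    (hode : ∀ ω > (0:ℝ), ∀ t : ℝ,
      deriv (deriv (xω ω)) t = ω • cross (deriv (xω ω) t) (B (xω ω t)))
    (hinit : ∀ ω > (0:ℝ), xω ω 0 = x₀ ∧ deriv (xω ω) 0 = v₀)
    (ρω : ℝ → ℝ → E3)
    (hρ : ∀ ω t, ρω ω t = (ω * ‖B (xω ω t)‖)⁻¹ • cross (b (xω ω t)) (deriv (xω ω) t))
    (T : ℝ) (hT : 0 < T) :
    Tendsto (fun ω : ℝ => ω • (T⁻¹ • ∫ t in (0:ℝ)..T, ρω ω t)) atTop (nhds 0) := by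
  set g : E3 → ℝ := fun y => (‖B y‖ ^ 2)⁻¹ with hgdef
  have hg : ContDiff ℝ 1 g :=
    ((hB.of_le one_le_two).norm_sq ℝ).inv fun y => pow_ne_zero _ (norm_ne_zero_iff.2 (hne y))
  have hK : IsCompact (Metric.closedBall x₀ (‖v₀‖ * T)) := isCompact_closedBall _ _
  obtain ⟨C, hC⟩ := hK.exists_bound_of_continuousOn hg.continuous.continuousOn
  obtain ⟨D, hD⟩ := hK.exists_bound_of_continuousOn
    (hg.continuous_fderiv one_ne_zero).continuousOn
  have hbound : ∀ ω > (0:ℝ), ‖ω • (T⁻¹ • ∫ t in (0:ℝ)..T, ρω ω t)‖ ≤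
      ω⁻¹ * (T⁻¹ * (2 * (C * ‖v₀‖) + D * ‖v₀‖ * ‖v₀‖ * T)) := fun ω hω => by
    have hs : ∀ t, ‖deriv (xω ω) t‖ = ‖v₀‖ := fun t => by
      rw [norm_deriv_eq_of_lorentz (hxC ω hω) (hode ω hω) t, (hinit ω hω).2]
    have hmem : ∀ t ∈ Set.Icc 0 T, xω ω t ∈ Metric.closedBall x₀ (‖v₀‖ * T) := fun t ht => by
      have h := convex_univ.norm_image_sub_le_of_norm_deriv_le (f := xω ω) (C := ‖v₀‖)
        (fun t _ => (hxC ω hω).differentiable two_ne_zero t) (fun t _ => (hs t).le)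
        (Set.mem_univ 0) (Set.mem_univ t)
      rw [(hinit ω hω).1, sub_zero, Real.norm_of_nonneg ht.1] at h
      rw [mem_closedBall_iff_norm]
      exact h.trans (mul_le_mul_of_nonneg_left ht.2 (norm_nonneg _))
    have hρ' : ∀ t, ρω ω t = -(ω⁻¹ * ω⁻¹) • (g (xω ω t) • deriv (deriv (xω ω)) t) := fun t => by
      rw [hρ, hb, hode ω hω, cross_smul_left, cross_swap (B _), smul_neg, smul_neg, neg_smul,
        smul_smul, smul_smul, smul_smul]
      congr 2
      have := norm_ne_zero_iff.2 (hne (xω ω t))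
      simp only [hgdef]
      field_simp
    simp only [hρ', intervalIntegral.integral_smul]
    have hint := norm_integral_smul_deriv_deriv_le hg (hxC ω hω) hT.le hs
      (fun t ht => hC _ (hmem t ht)) (fun t ht => hD _ (hmem t ht))
    calc _ = ω⁻¹ * (T⁻¹ * ‖∫ t in (0:ℝ)..T, g (xω ω t) • deriv (deriv (xω ω)) t‖) := by
          rw [norm_smul, norm_smul, norm_smul, norm_neg, norm_mul, norm_inv, norm_inv,
            Real.norm_of_nonneg hω.le, Real.norm_of_nonneg hT.le]
          field_simp
      _ ≤ _ := by gcongr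
  refine squeeze_zero_norm' ((eventually_gt_atTop 0).mono hbound) ?_
  simpa using tendsto_inv_atTop_zero.mul_const
    (T⁻¹ * (2 * (C * ‖v₀‖) + D * ‖v₀‖ * ‖v₀‖ * T))
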